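/- arXiv:2007.06421 — 2 statements merged into one kernel-verified Lean document; each statement's English description precedes it below -/
import Mathlib

section
/- If T is a terminated trace of a pre-product of automata A and A', then left(T) is a terminated trace of A and right(T) is a terminated trace of A'. -/
/-- An automaton: distinct initial and final controls, and a transition relation on
states (control–store pairs) satisfying finality and non-stuttering. -/
structure Automaton (Ctrl : Type*) (Sto : Type*) where
  init : Ctrl
  fin : Ctrl
  init_ne_fin : init ≠ fin
  step : Ctrl × Sto → Ctrl × Sto → Prop
  finality : ∀ {γ β : Ctrl × Sto}, step γ β → γ.1 ≠ fin
  nonstutter : ∀ {γ β : Ctrl × Sto}, step γ β → γ.1 ≠ β.1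

variable {Ctrl Sto Ctrl' Sto' : Type*}

/-- A trace: a nonempty finite sequence of states, consecutive under the transition
relation, whose first state has control `init`. -/
def Automaton.IsTrace (A : Automaton Ctrl Sto) (τ : List (Ctrl × Sto)) : Prop :=
  τ ≠ [] ∧ List.Chain' A.step τ ∧ ∀ h : τ ≠ [], (τ.head h).1 = A.init

/-- A terminated trace: a trace whose last state has control `fin`. -/
def Automaton.IsTerminated (A : Automaton Ctrl Sto) (τ : List (Ctrl × Sto)) : Prop :=
  A.IsTrace τ ∧ ∀ h : τ ≠ [], (τ.getLast h).1 = A.fin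

/-- A finite trace satisfies the spec ⟨P,Q⟩ in the basic semantics. -/
def Automaton.TraceSat (A : Automaton Ctrl Sto) (P Q : Sto → Prop)
    (τ : List (Ctrl × Sto)) : Prop :=
  ∀ h : τ ≠ [], P (τ.head h).2 → (τ.getLast h).1 = A.fin → Q (τ.getLast h).2

/-- An automaton satisfies the spec ⟨P,Q⟩ (basic semantics) iff all its finite traces do. -/
def Automaton.Sat (A : Automaton Ctrl Sto) (P Q : Sto → Prop) : Prop :=
  ∀ τ, A.IsTrace τ → A.TraceSat P Q τ

/-- Traces τ of A and τ' of A' satisfy the relational spec ⟨R,S⟩. -/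
def RelTraceSat (A : Automaton Ctrl Sto) (A' : Automaton Ctrl' Sto')
    (R S : Sto → Sto' → Prop)
    (τ : List (Ctrl × Sto)) (τ' : List (Ctrl' × Sto')) : Prop :=
  ∀ (h : τ ≠ []) (h' : τ' ≠ []),
    R (τ.head h).2 (τ'.head h').2 →
    (τ.getLast h).1 = A.fin → (τ'.getLast h').1 = A'.fin →
    S (τ.getLast h).2 (τ'.getLast h').2

/-- The pair A, A' satisfies the relational spec ⟨R,S⟩ iff all pairs of finite traces do. -/
def RelSat (A : Automaton Ctrl Sto) (A' : Automaton Ctrl' Sto')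
    (R S : Sto → Sto' → Prop) : Prop :=
  ∀ τ τ', A.IsTrace τ → A'.IsTrace τ' → RelTraceSat A A' R S τ τ'

/-- Remove from a list each element equal to its immediate predecessor. -/
noncomputable def destutter {α : Type*} (l : List α) : List α :=
  letI : DecidableRel (α := α) (· ≠ ·) := fun _ _ => Classical.propDecidable _
  List.destutter (· ≠ ·) l

/-- The A-state component of a state of a product of A and A'. -/
def leftSt (γ : (Ctrl × Ctrl') × (Sto × Sto')) : Ctrl × Sto := (γ.1.1, γ.2.1)

/-- The A'-state component of a state of a product of A and A'. -/
def rightSt (γ : (Ctrl × Ctrl') × (Sto × Sto')) : Ctrl' × Sto' := (γ.1.2, γ.2.2)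

/-- left(T) = destutter (map fst T). -/
noncomputable def leftTrace (T : List ((Ctrl × Ctrl') × (Sto × Sto'))) :
    List (Ctrl × Sto) :=
  destutter (T.map leftSt)

/-- right(T) = destutter (map snd T). -/
noncomputable def rightTrace (T : List ((Ctrl × Ctrl') × (Sto × Sto'))) :
    List (Ctrl' × Sto') :=
  destutter (T.map rightSt)

/-- P is a pre-product of A and A': an automaton on control set Ctrl × Ctrl' and
store set Sto × Sto', with initial control (init, init'), final control (fin, fin'),
whose transition relation is contained in (↦ ⊗ ↦') ∪ (↦ ⊗ id) ∪ (id ⊗ ↦'). -/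
def IsPreProduct (A : Automaton Ctrl Sto) (A' : Automaton Ctrl' Sto')
    (P : Automaton (Ctrl × Ctrl') (Sto × Sto')) : Prop :=
  P.init = (A.init, A'.init) ∧ P.fin = (A.fin, A'.fin) ∧
  ∀ γ β, P.step γ β →
    (A.step (leftSt γ) (leftSt β) ∧ A'.step (rightSt γ) (rightSt β)) ∨
    (A.step (leftSt γ) (leftSt β) ∧ rightSt γ = rightSt β) ∨
    (leftSt γ = leftSt β ∧ A'.step (rightSt γ) (rightSt β))

/-- Adequacy: every pair of finite traces of A and A' is covered by some trace of P. -/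
def Adequate (A : Automaton Ctrl Sto) (A' : Automaton Ctrl' Sto')
    (P : Automaton (Ctrl × Ctrl') (Sto × Sto')) : Prop :=
  ∀ τ τ', A.IsTrace τ → A'.IsTrace τ' →
    ∃ T, P.IsTrace T ∧ τ <+: leftTrace T ∧ τ' <+: rightTrace T

/-- Weak adequacy: every pair of finite prefixes of terminated traces of A and A'
(that are themselves traces) is covered by some trace of P. -/
def WeaklyAdequate (A : Automaton Ctrl Sto) (A' : Automaton Ctrl' Sto')
    (P : Automaton (Ctrl × Ctrl') (Sto × Sto')) : Prop :=
  ∀ τ τ', A.IsTrace τ → A'.IsTrace τ' →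
    (∃ σ, A.IsTerminated σ ∧ τ <+: σ) →
    (∃ σ', A'.IsTerminated σ' ∧ τ' <+: σ') →
    ∃ T, P.IsTrace T ∧ τ <+: leftTrace T ∧ τ' <+: rightTrace T

/-- No stuck states: every state whose control is not fin has a successor. -/
def NoStuck (A : Automaton Ctrl Sto) : Prop :=
  ∀ γ : Ctrl × Sto, γ.1 ≠ A.fin → ∃ β, A.step γ β

/-- Only-lockstep transitions: both sides step. -/
def lockstepStep (A : Automaton Ctrl Sto) (A' : Automaton Ctrl' Sto')
    (γ β : (Ctrl × Ctrl') × (Sto × Sto')) : Prop :=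
  A.step (leftSt γ) (leftSt β) ∧ A'.step (rightSt γ) (rightSt β)

/-- Interleaved transitions: exactly one side steps. -/
def interleavedStep (A : Automaton Ctrl Sto) (A' : Automaton Ctrl' Sto')
    (γ β : (Ctrl × Ctrl') × (Sto × Sto')) : Prop :=
  (A.step (leftSt γ) (leftSt β) ∧ rightSt γ = rightSt β) ∨
  (leftSt γ = leftSt β ∧ A'.step (rightSt γ) (rightSt β))

section Destutter

variable {α : Type*}

theorem head?_destutter'_ne [DecidableRel (α := α) (· ≠ ·)] (a : α) (l : List α) :
    (List.destutter' (· ≠ ·) a l).head? = some a := by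
  induction l with
  | nil => rfl
  | cons b l ih =>
    rw [List.destutter'_cons]
    split_ifs
    · rfl
    · exact ih

theorem getLast?_destutter'_ne [DecidableRel (α := α) (· ≠ ·)] (a : α) (l : List α) :
    (List.destutter' (· ≠ ·) a l).getLast? = (a :: l).getLast? := by
  induction l generalizing a with
  | nil => rfl
  | cons b l ih =>
    rw [List.destutter'_cons, List.getLast?_cons_cons]
    split_ifs with h
    · rw [List.getLast?_cons, ih]
      simp [List.getLast?_cons]
    · rw [ih, not_not.mp h]

theorem isChain_destutter'_ne [DecidableRel (α := α) (· ≠ ·)] {S : α → α → Prop} (a : α)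
    (l : List α) (h : (a :: l).IsChain fun x y => S x y ∨ x = y) :
    (List.destutter' (· ≠ ·) a l).IsChain S := by
  induction l generalizing a with
  | nil => exact List.isChain_singleton a
  | cons b l ih =>
    obtain ⟨hab, hl⟩ := List.isChain_cons_cons.mp h
    rw [List.destutter'_cons]
    split_ifs with hne
    · refine List.isChain_cons.mpr ⟨fun y hy => ?_, ih b hl⟩
      rw [head?_destutter'_ne] at hy
      obtain rfl := Option.mem_some_iff.mp hy
      exact hab.resolve_right hne
    · rw [not_not.mp hne]
      exact ih b hl

theorem head?_destutter (l : List α) : (destutter l).head? = l.head? := by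
  cases l with
  | nil => rfl
  | cons a l =>
    let _ : DecidableRel (α := α) (· ≠ ·) := fun _ _ => Classical.propDecidable _
    exact head?_destutter'_ne a l

theorem destutter_eq_nil {l : List α} : destutter l = [] ↔ l = [] := by
  rw [← List.head?_eq_none_iff, head?_destutter, List.head?_eq_none_iff]

theorem getLast?_destutter (l : List α) : (destutter l).getLast? = l.getLast? := by
  cases l with
  | nil => rfl
  | cons a l =>
    let _ : DecidableRel (α := α) (· ≠ ·) := fun _ _ => Classical.propDecidable _
    exact getLast?_destutter'_ne a l

/-- If consecutive elements of `l` are equal or related by `S`, then the destuttering of `l`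
is an `S`-chain. -/
theorem isChain_destutter {S : α → α → Prop} {l : List α}
    (h : l.IsChain fun x y => S x y ∨ x = y) : (destutter l).IsChain S := by
  cases l with
  | nil => exact List.isChain_nil
  | cons a l =>
    let _ : DecidableRel (α := α) (· ≠ ·) := fun _ _ => Classical.propDecidable _
    exact isChain_destutter'_ne a l h

end Destutter

/-- A state map that preserves initial and final controls and sends steps to steps or
identities takes terminated traces to terminated traces, after destuttering. -/
theorem Automaton.IsTerminated.destutter_map {B : Automaton Ctrl Sto} {A : Automaton Ctrl' Sto'}
    {f : Ctrl × Sto → Ctrl' × Sto'}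
    (hinit : ∀ γ, γ.1 = B.init → (f γ).1 = A.init)
    (hfin : ∀ γ, γ.1 = B.fin → (f γ).1 = A.fin)
    (hstep : ∀ γ β, B.step γ β → A.step (f γ) (f β) ∨ f γ = f β)
    {τ : List (Ctrl × Sto)} (hτ : B.IsTerminated τ) :
    A.IsTerminated (destutter (τ.map f)) := by
  obtain ⟨⟨hne, hchain, hhead⟩, hlast⟩ := hτ
  refine ⟨⟨?_, ?_, fun h => ?_⟩, fun h => ?_⟩
  · simpa [destutter_eq_nil] using hne
  · exact isChain_destutter ((List.isChain_map f).mpr (hchain.imp hstep))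
  · have key := head?_destutter (τ.map f)
    rw [List.head?_eq_some_head h, List.head?_map, List.head?_eq_some_head hne] at key
    rw [Option.some.inj key]
    exact hinit _ (hhead hne)
  · have key := getLast?_destutter (τ.map f)
    rw [List.getLast?_eq_some_getLast h, List.getLast?_map,
      List.getLast?_eq_some_getLast hne] at key
    rw [Option.some.inj key]
    exact hfin _ (hlast hne)

/-- For a terminated trace T of a pre-product of A and A', left(T) is a
terminated trace of A and right(T) is a terminated trace of A'. -/
theorem left_right_of_preproduct_terminated
    (A : Automaton Ctrl Sto) (A' : Automaton Ctrl' Sto')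
    (P : Automaton (Ctrl × Ctrl') (Sto × Sto'))
    (hpre : IsPreProduct A A' P)
    (T : List ((Ctrl × Ctrl') × (Sto × Sto'))) (hT : P.IsTerminated T) :
    A.IsTerminated (leftTrace T) ∧ A'.IsTerminated (rightTrace T) := by
  obtain ⟨hinit, hfin, hstep⟩ := hpre
  constructor
  · refine hT.destutter_map (fun γ h => ?_) (fun γ h => ?_) fun γ β h => ?_
    · exact congrArg Prod.fst (h.trans hinit)
    · exact congrArg Prod.fst (h.trans hfin)
    · have := hstep γ β h
      tauto
  · refine hT.destutter_map (fun γ h => ?_) (fun γ h => ?_) fun γ β h => ?_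
    · exact congrArg Prod.snd (h.trans hinit)
    · exact congrArg Prod.snd (h.trans hfin)
    · have := hstep γ β h
      tauto
end

section
/- For any automata A and A', the maximal pre-product of A and A' (whose transition relation is the union of the only-lockstep and interleaved transition relations) is adequate. -/
variable {Ctrl Sto Ctrl' Sto' : Type*}

/-- The maximal pre-product automaton: union of only-lockstep and interleaved. -/
def Automaton.maximal (A : Automaton Ctrl Sto) (A' : Automaton Ctrl' Sto') :
    Automaton (Ctrl × Ctrl') (Sto × Sto') where
  init := (A.init, A'.init)
  fin := (A.fin, A'.fin)
  init_ne_fin := fun h => A.init_ne_fin (congrArg Prod.fst h)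
  step γ β := lockstepStep A A' γ β ∨ interleavedStep A A' γ β
  finality := by
    intro γ β h e
    unfold lockstepStep interleavedStep at h
    rcases h with ⟨h, -⟩ | ⟨h, -⟩ | ⟨-, h⟩
    · exact A.finality h (show γ.1.1 = A.fin by rw [e])
    · exact A.finality h (show γ.1.1 = A.fin by rw [e])
    · exact A'.finality h (show γ.1.2 = A'.fin by rw [e])
  nonstutter := by
    intro γ β h e
    unfold lockstepStep interleavedStep at h
    rcases h with ⟨h, -⟩ | ⟨h, -⟩ | ⟨-, h⟩
    · exact A.nonstutter h (show γ.1.1 = β.1.1 by rw [e])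
    · exact A.nonstutter h (show γ.1.1 = β.1.1 by rw [e])
    · exact A'.nonstutter h (show γ.1.2 = β.1.2 by rw [e])

theorem destutter_cons_cons_ne {α : Type*} {a b : α} (l : List α) (h : a ≠ b) :
    destutter (a :: b :: l) = a :: destutter (b :: l) := by
  simp [destutter, List.destutter, List.destutter', h]

theorem destutter_cons_cons_self {α : Type*} (a : α) (l : List α) :
    destutter (a :: a :: l) = destutter (a :: l) := by
  simp [destutter, List.destutter, List.destutter']

theorem Automaton.ne_of_step (A : Automaton Ctrl Sto) {γ β : Ctrl × Sto} (h : A.step γ β) :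
    γ ≠ β :=
  fun e => A.nonstutter h (congrArg Prod.fst e)

/-- The product state with the given components. -/
def pairSt (a : Ctrl × Sto) (b : Ctrl' × Sto') : (Ctrl × Ctrl') × (Sto × Sto') :=
  ((a.1, b.1), (a.2, b.2))

@[simp] theorem leftSt_pairSt (a : Ctrl × Sto) (b : Ctrl' × Sto') : leftSt (pairSt a b) = a := rfl

@[simp] theorem rightSt_pairSt (a : Ctrl × Sto) (b : Ctrl' × Sto') :
    rightSt (pairSt a b) = b := rfl

/-- Any two runs are the projections of a run of the maximal pre-product, namely the one
that performs all left steps first. -/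
theorem exists_isChain_maximal (A : Automaton Ctrl Sto) (A' : Automaton Ctrl' Sto')
    (τ : List (Ctrl × Sto)) (τ' : List (Ctrl' × Sto')) (a : Ctrl × Sto) (a' : Ctrl' × Sto')
    (h : List.IsChain A.step (a :: τ)) (h' : List.IsChain A'.step (a' :: τ')) :
    ∃ T, List.IsChain (A.maximal A').step (pairSt a a' :: T) ∧
      leftTrace (pairSt a a' :: T) = a :: τ ∧ rightTrace (pairSt a a' :: T) = a' :: τ' := by
  induction τ generalizing a with
  | cons b τ ih =>
    rw [List.isChain_cons_cons] at h
    obtain ⟨T, hT, hl, hr⟩ := ih b h.2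
    refine ⟨pairSt b a' :: T, List.isChain_cons_cons.2 ⟨.inr (.inl ⟨h.1, rfl⟩), hT⟩, ?_, ?_⟩
    · simpa [leftTrace, destutter_cons_cons_ne _ (A.ne_of_step h.1)] using hl
    · simpa [rightTrace, destutter_cons_cons_self] using hr
  | nil =>
    induction τ' generalizing a' with
    | nil => exact ⟨[], by simp, by simp [leftTrace, destutter], by simp [rightTrace, destutter]⟩
    | cons b' τ' ih =>
      rw [List.isChain_cons_cons] at h'
      obtain ⟨T, hT, hl, hr⟩ := ih b' h'.2
      refine ⟨pairSt a b' :: T, List.isChain_cons_cons.2 ⟨.inr (.inr ⟨rfl, h'.1⟩), hT⟩, ?_, ?_⟩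
      · simpa [leftTrace, destutter_cons_cons_self] using hl
      · simpa [rightTrace, destutter_cons_cons_ne _ (A'.ne_of_step h'.1)] using hr

/-- The maximal pre-product of A and A' is adequate. -/
theorem maximal_adequate
    (A : Automaton Ctrl Sto) (A' : Automaton Ctrl' Sto') :
    Adequate A A' (A.maximal A') := by
  rintro (_ | ⟨a, τ⟩) (_ | ⟨a', τ'⟩) ⟨hne, hc, hi⟩ ⟨hne', hc', hi'⟩
  · exact absurd rfl hne
  · exact absurd rfl hne
  · exact absurd rfl hne'
  · obtain ⟨T, hT, hl, hr⟩ := exists_isChain_maximal A A' τ τ' a a' hc hc'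
    exact ⟨pairSt a a' :: T,
      ⟨List.cons_ne_nil _ _, hT, fun _ => Prod.ext (hi hne) (hi' hne')⟩,
      hl ▸ List.prefix_rfl, hr ▸ List.prefix_rfl⟩
end
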